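/- Let F be an (m,s)-function with s ≥ 2 and λ ∈ GF(2^s)\{0}. Then for every y ∈ GF(2^s)\{0,λ} and every a ∈ GF(2^m), the codeword c_{a,y} of C_{D_{f_λ}} satisfies wt(c_{a,y}) = (2·n_{f_λ} − Ŵ_F(y,a) + Ŵ_F(y+λ,a))/4. -/

import Mathlib

open Finset
noncomputable section
open scoped Classical

/-- `GF n` is the finite field with `2^n` elements. -/
abbrev GF (n : ℕ) : Type := GaloisField 2 n

noncomputable instance (n : ℕ) : Fintype (GF n) := Fintype.ofFinite _

/-- The absolute trace map `GF n → 𝔽₂`. -/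
def tr {n : ℕ} (x : GF n) : ZMod 2 := Algebra.trace (ZMod 2) (GF n) x

/-- The Walsh transform of an `(m,s)`-function `F` at `(α, β)`. -/
def walshF {m s : ℕ} (F : GF m → GF s) (α : GF s) (β : GF m) : ℤ :=
  ∑ x : GF m, (-1 : ℤ) ^ (tr (α * F x) + tr (β * x)).val

/-- The support `D_{f_λ}` of the component function `f_λ = Tr(λ·F)`. -/
abbrev Dsupp {m s : ℕ} (F : GF m → GF s) (lam : GF s) : Type :=
  {d : GF m // tr (lam * F d) = 1}

/-- `n_{f_λ}`, the cardinality of the support of `f_λ`. -/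
def nSupp {m s : ℕ} (F : GF m → GF s) (lam : GF s) : ℕ := Fintype.card (Dsupp F lam)

/-- The codeword `c_{x,y} = (Tr(x·d) + Tr(y·F(d)))_{d ∈ D_{f_λ}}`. -/
def cw {m s : ℕ} (F : GF m → GF s) (lam : GF s) (x : GF m) (y : GF s) :
    Dsupp F lam → ZMod 2 :=
  fun d => tr (x * d.1) + tr (y * F d.1)

/-- Hamming weight of the codeword `c_{x,y}`. -/
def wtc {m s : ℕ} (F : GF m → GF s) (lam : GF s) (x : GF m) (y : GF s) : ℕ :=
  (univ.filter (fun d : Dsupp F lam => cw F lam x y d ≠ 0)).card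

lemma tr_add {n : ℕ} (x y : GF n) : tr (x + y) = tr x + tr y :=
  map_add (Algebra.trace (ZMod 2) (GF n)) x y

lemma nSupp_eq_sum {m s : ℕ} (F : GF m → GF s) (lam : GF s) :
    (nSupp F lam : ℤ) = ∑ x : GF m, if tr (lam * F x) = 1 then 1 else 0 := by
  rw [nSupp, Fintype.card_subtype, Finset.natCast_card_filter]

lemma wtc_eq_sum {m s : ℕ} (F : GF m → GF s) (lam : GF s) (a : GF m) (y : GF s) :
    (wtc F lam a y : ℤ) = ∑ x : GF m,
      if tr (lam * F x) = 1 then (if tr (a * x) + tr (y * F x) ≠ 0 then 1 else 0) else 0 := by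
  rw [← Finset.sum_filter, wtc, Finset.natCast_card_filter]
  exact (Finset.sum_subtype (univ.filter fun x => tr (lam * F x) = 1)
    (fun x => by rw [mem_filter, and_iff_right (mem_univ x)])
    (fun x => if tr (a * x) + tr (y * F x) ≠ 0 then (1 : ℤ) else 0)).symm

lemma four_mul_indicator_eq (u v w : ZMod 2) :
    (4 : ℤ) * (if w = 1 then (if u + v ≠ 0 then 1 else 0) else 0) =
      2 * (if w = 1 then 1 else 0) - (-1) ^ (v + u).val + (-1) ^ (v + w + u).val := by
  have h : ∀ t : ZMod 2, t = 0 ∨ t = 1 := by decide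
  have h11 : (1 + 1 : ZMod 2) = 0 := rfl
  rcases h u with rfl | rfl <;> rcases h v with rfl | rfl <;> rcases h w with rfl | rfl <;>
    simp [h11, ZMod.val_one]

lemma four_mul_wtc {m s : ℕ} (F : GF m → GF s) (lam : GF s) (a : GF m) (y : GF s) :
    (4 : ℤ) * wtc F lam a y = 2 * nSupp F lam - walshF F y a + walshF F (y + lam) a := by
  rw [wtc_eq_sum, nSupp_eq_sum, walshF, walshF, Finset.mul_sum, Finset.mul_sum,
    ← Finset.sum_sub_distrib, ← Finset.sum_add_distrib]
  refine Finset.sum_congr rfl fun x _ => ?_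
  rw [add_mul, tr_add]
  exact four_mul_indicator_eq _ _ _

/-- weight of the codeword `c_{a,y}` of `C_{D_{f_λ}}` for `y ∉ {0, λ}`. -/
theorem stmt18 (m s : ℕ) (hm : 1 ≤ m) (hs : 2 ≤ s)
    (F : GF m → GF s) (lam : GF s) (hlam : lam ≠ 0) :
    ∀ y : GF s, y ≠ 0 → y ≠ lam → ∀ a : GF m,
      (wtc F lam a y : ℚ) =
        (2 * (nSupp F lam : ℚ) - (walshF F y a : ℚ) + (walshF F (y + lam) a : ℚ)) / 4 := by
  intro y _ _ a
  have h : (4 : ℚ) * wtc F lam a y = 2 * nSupp F lam - walshF F y a + walshF F (y + lam) a :=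
    mod_cast four_mul_wtc F lam a y
  rw [← h]
  ring
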